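/- (A variant of the Azuma–Hoeffding inequality) Let ξ_1, …, ξ_T be a martingale difference sequence with respect to a filtration (𝔉_t)_{t=0}^{T}, and suppose there are constants b_t ≥ 1 and c_t > 0 such that for every θ > 0 and every t ∈ {1, …, T}, almost surely ℙ(ξ_t > θ | 𝔉_{t−1}) ≤ b_t·exp(−c_t θ²) and ℙ(ξ_t < −θ | 𝔉_{t−1}) ≤ b_t·exp(−c_t θ²). Then for every δ ∈ (0,1), with probability at least 1 − δ, (1/T) Σ_{t=1}^T ξ_t ≤ √(28 (Σ_{t=1}^T b_t/c_t) log(1/δ) / T²). -/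

import Mathlib

open MeasureTheory
open scoped BigOperators

lemma aux_exp_le (x : ℝ) : Real.exp x ≤ x + Real.exp (x^2) := by
  have h1 := Real.add_one_le_exp (x^2)
  rcases le_or_gt |x| 1 with h | h
  · have := (abs_le.1 (Real.abs_exp_sub_one_sub_id_le h)).2
    linarith
  · rcases lt_abs.1 h with h | h
    · have : Real.exp x ≤ Real.exp (x^2) := Real.exp_le_exp.2 (by nlinarith)
      linarith
    · have : Real.exp x ≤ 1 := Real.exp_le_one_iff.2 (by linarith)
      nlinarith

lemma aux_gauss {d : ℝ} (hd : 0 < d) :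
    ∫⁻ t in Set.Ioi (0:ℝ), ENNReal.ofReal (t * Real.exp (-d * t^2)) = ENNReal.ofReal (1/(2*d)) := by
  have hi := (integrable_mul_exp_neg_mul_sq hd).integrableOn (s := Set.Ioi 0)
  rw [← ofReal_integral_eq_lintegral_ofReal hi]
  · congr 1
    have h := integral_mul_cexp_neg_mul_sq (b := (d:ℂ)) (by simpa using hd)
    have h2 : ∀ r : ℝ, (r:ℂ) * Complex.exp (-(d:ℂ) * (r:ℂ)^2)
      = ((r * Real.exp (-d * r^2) : ℝ) : ℂ) := by
      intro r; push_cast; rfl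
    simp_rw [h2] at h
    rw [integral_complex_ofReal] at h
    have : (((2 * d)⁻¹ : ℝ) : ℂ) = (2 * (d:ℂ))⁻¹ := by push_cast; rfl
    rw [← this] at h
    rw [one_div]
    exact_mod_cast h
  · filter_upwards [ae_restrict_mem measurableSet_Ioi] with t ht
    have : (0:ℝ) < t := ht
    positivity

lemma aux_sq_exp {Ω : Type*} {m0 : MeasurableSpace Ω} (ν : Measure Ω) [IsFiniteMeasure ν]
    (X : Ω → ℝ) (hX : Measurable X) (b c a : ℝ) (hb : 1 ≤ b) (ha : 0 < a) (hac : a < c)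
    (h1 : ∀ θ : ℝ, 0 < θ → ν {ω | θ < X ω} ≤ ENNReal.ofReal (b * Real.exp (-(c * θ^2))) * ν Set.univ)
    (h2 : ∀ θ : ℝ, 0 < θ → ν {ω | X ω < -θ} ≤ ENNReal.ofReal (b * Real.exp (-(c * θ^2))) * ν Set.univ) :
    ∫⁻ ω, ENNReal.ofReal (Real.exp (a * (X ω)^2)) ∂ν
      ≤ ENNReal.ofReal (1 + 2 * b * a / (c - a)) * ν Set.univ := by
  have hd : 0 < c - a := by linarith
  have hcont : Continuous (fun t : ℝ => 2 * a * t * Real.exp (a * t^2)) := by fun_prop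
  have hF : ∀ x : ℝ, ∫ t in (0:ℝ)..x, 2 * a * t * Real.exp (a * t^2) = Real.exp (a * x^2) - 1 := by
    intro x
    have := intervalIntegral.integral_eq_sub_of_hasDerivAt (a := 0) (b := x)
      (f := fun t : ℝ => Real.exp (a * t^2))
      (f' := fun t : ℝ => 2 * a * t * Real.exp (a * t^2)) (fun t _ => by
        have := (((hasDerivAt_id t).pow 2).const_mul a).exp
        convert! this using 1
        simp; ring) (hcont.intervalIntegrable _ _)
    rw [this]; simp
  have hlc := lintegral_comp_eq_lintegral_meas_lt_mul ν (f := fun ω => |X ω|)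
    (g := fun t : ℝ => 2 * a * t * Real.exp (a * t^2)) (ae_of_all _ fun ω => abs_nonneg _)
    (by fun_prop) (fun t _ => hcont.intervalIntegrable _ _)
    (by
      filter_upwards [ae_restrict_mem measurableSet_Ioi] with t ht
      have : (0:ℝ) < t := ht
      positivity)
  simp only [hF, sq_abs] at hlc
  have hb2 : ∫⁻ ω, ENNReal.ofReal (Real.exp (a * (X ω)^2) - 1) ∂ν
      ≤ ENNReal.ofReal (2 * b * a / (c - a)) * ν Set.univ := by
    rw [hlc]
    calc _ ≤ ∫⁻ t in Set.Ioi (0:ℝ), (ENNReal.ofReal (4 * a * b) * ν Set.univ) *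
            ENNReal.ofReal (t * Real.exp (-(c-a) * t^2)) := by
          refine setLIntegral_mono' measurableSet_Ioi fun t ht => ?_
          have ht : (0:ℝ) < t := ht
          have hs : {ω | t < |X ω|} ⊆ {ω | t < X ω} ∪ {ω | X ω < -t} := by
            intro ω hω
            rcases lt_abs.1 (show t < |X ω| from hω) with h | h
            · exact Or.inl h
            · exact Or.inr (show X ω < -t by linarith)
          have hm : ν {ω | t < |X ω|} ≤
              ENNReal.ofReal (2 * b * Real.exp (-(c * t^2))) * ν Set.univ := by
            refine (measure_mono hs).trans ((measure_union_le _ _).trans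
              ((add_le_add (h1 t ht) (h2 t ht)).trans (le_of_eq ?_)))
            rw [← add_mul, ← ENNReal.ofReal_add (by positivity) (by positivity)]
            congr 2; ring
          refine (mul_le_mul_left hm _).trans (le_of_eq ?_)
          rw [mul_right_comm, ← ENNReal.ofReal_mul (by positivity),
            mul_right_comm (ENNReal.ofReal (4 * a * b)), ← ENNReal.ofReal_mul (by positivity)]
          congr 2
          have : Real.exp (-(c-a) * t^2) = Real.exp (-(c * t^2)) * Real.exp (a * t^2) := by
            rw [← Real.exp_add]; congr 1; ring
          rw [this]; ring
      _ = _ := by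
          rw [lintegral_const_mul _ (by fun_prop), aux_gauss hd, mul_right_comm,
            ← ENNReal.ofReal_mul (by positivity)]
          congr 2; field_simp; ring
  calc _ = ∫⁻ ω, (ENNReal.ofReal (Real.exp (a * (X ω)^2) - 1) + 1) ∂ν := by
        refine lintegral_congr fun ω => ?_
        have : 1 ≤ Real.exp (a * (X ω)^2) := Real.one_le_exp (by positivity)
        rw [← ENNReal.ofReal_one, ← ENNReal.ofReal_add (by linarith) (by simp)]
        simp
    _ = ∫⁻ ω, ENNReal.ofReal (Real.exp (a * (X ω)^2) - 1) ∂ν + ν Set.univ := by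
        rw [lintegral_add_right _ measurable_const]; simp
    _ ≤ ENNReal.ofReal (2 * b * a / (c - a)) * ν Set.univ + ν Set.univ := by gcongr
    _ = _ := by
        rw [add_comm 1, ENNReal.ofReal_add (by positivity) (by simp), add_mul]; simp

lemma aux_mgf {Ω : Type*} {m0 : MeasurableSpace Ω} (ν : Measure Ω) [IsFiniteMeasure ν]
    (X : Ω → ℝ) (hX : Measurable X) (b c l : ℝ) (hb : 1 ≤ b) (hc : 0 < c)
    (hi : Integrable X ν) (h0 : ∫ ω, X ω ∂ν = 0)
    (h1 : ∀ θ : ℝ, 0 < θ → ν {ω | θ < X ω} ≤ ENNReal.ofReal (b * Real.exp (-(c * θ^2))) * ν Set.univ)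
    (h2 : ∀ θ : ℝ, 0 < θ → ν {ω | X ω < -θ} ≤ ENNReal.ofReal (b * Real.exp (-(c * θ^2))) * ν Set.univ) :
    ∫⁻ ω, ENNReal.ofReal (Real.exp (l * X ω)) ∂ν
      ≤ ENNReal.ofReal (Real.exp (7 * l^2 * (b / c))) * ν Set.univ := by
  rcases eq_or_ne l 0 with rfl | hl
  · simp
  have hl2 : 0 < l^2 := by positivity
  rcases le_or_gt (l^2) (c/2) with h | h
  · have hs := aux_sq_exp ν X hX b c (l^2) hb hl2 (by linarith) h1 h2
    have hI : Integrable (fun ω => Real.exp (l^2 * (X ω)^2)) ν := by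
      refine ⟨by fun_prop, ?_⟩
      rw [hasFiniteIntegral_iff_ofReal (ae_of_all _ fun ω => (Real.exp_pos _).le)]
      exact hs.trans_lt (ENNReal.mul_lt_top ENNReal.ofReal_lt_top (measure_lt_top _ _))
    have hle : ∀ ω, Real.exp (l * X ω) ≤ l * X ω + Real.exp (l^2 * (X ω)^2) := fun ω => by
      have := aux_exp_le (l * X ω)
      rwa [mul_pow] at this
    have hI2 : Integrable (fun ω => l * X ω + Real.exp (l^2 * (X ω)^2)) ν := (hi.const_mul l).add hI
    calc _ ≤ ∫⁻ ω, ENNReal.ofReal (l * X ω + Real.exp (l^2 * (X ω)^2)) ∂ν :=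
          lintegral_mono fun ω => ENNReal.ofReal_le_ofReal (hle ω)
      _ = ENNReal.ofReal (∫ ω, (l * X ω + Real.exp (l^2 * (X ω)^2)) ∂ν) := by
          rw [ofReal_integral_eq_lintegral_ofReal hI2
            (ae_of_all _ fun ω => (Real.exp_pos _).le.trans (hle ω))]
      _ = ENNReal.ofReal (∫ ω, Real.exp (l^2 * (X ω)^2) ∂ν) := by
          rw [integral_add (hi.const_mul l) hI, integral_const_mul, h0]; simp
      _ = ∫⁻ ω, ENNReal.ofReal (Real.exp (l^2 * (X ω)^2)) ∂ν := by
          rw [ofReal_integral_eq_lintegral_ofReal hI (ae_of_all _ fun ω => (Real.exp_pos _).le)]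
      _ ≤ _ := hs.trans ?_
    gcongr
    refine le_trans ?_ (Real.add_one_le_exp _)
    rw [add_comm]
    gcongr
    rw [div_le_iff₀ (by linarith)]
    have : 7 * l^2 * (b/c) * (c - l^2) = 7 * l^2 * b * (1 - l^2/c) := by field_simp
    rw [this]
    have : l^2/c ≤ 1/2 := by rw [div_le_iff₀ hc]; linarith
    nlinarith [mul_pos hl2 (by linarith : 0 < b)]
  · have hs := aux_sq_exp ν X hX b c (c/2) hb (by linarith) (by linarith) h1 h2
    calc _ ≤ ∫⁻ ω, ENNReal.ofReal (Real.exp (l^2/(2*c))) *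
              ENNReal.ofReal (Real.exp (c/2 * (X ω)^2)) ∂ν := by
          refine lintegral_mono fun ω => ?_
          rw [← ENNReal.ofReal_mul (Real.exp_pos _).le, ← Real.exp_add]
          refine ENNReal.ofReal_le_ofReal (Real.exp_le_exp.2 ?_)
          have : l^2/(2*c) + c/2 * (X ω)^2 - l * X ω = (l - c * X ω)^2 / (2*c) := by
            field_simp; ring
          have : 0 ≤ (l - c * X ω)^2 / (2*c) := by positivity
          linarith
      _ = ENNReal.ofReal (Real.exp (l^2/(2*c))) *
            ∫⁻ ω, ENNReal.ofReal (Real.exp (c/2 * (X ω)^2)) ∂ν := by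
          rw [lintegral_const_mul _ (by fun_prop)]
      _ ≤ ENNReal.ofReal (Real.exp (l^2/(2*c))) *
            (ENNReal.ofReal (1 + 2 * b * (c/2) / (c - c/2)) * ν Set.univ) := by gcongr
      _ ≤ _ := ?_
    rw [← mul_assoc, ← ENNReal.ofReal_mul (Real.exp_pos _).le]
    gcongr
    have e1 : 1 + 2 * b * (c/2) / (c - c/2) = 1 + 2 * b := by field_simp; ring
    have hu : 1/2 < l^2/c := by rw [lt_div_iff₀ hc]; linarith
    have e2 : l^2/(2*c) = (l^2/c)/2 := by field_simp
    have e3 : 7 * l^2 * (b/c) = 7 * (l^2/c) * b := by field_simp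
    rw [e1, e2, e3]
    set u := l^2/c
    calc _ ≤ Real.exp (u/2) * Real.exp (2*b) := by
          gcongr; linarith [Real.add_one_le_exp (2*b)]
      _ ≤ _ := by
          rw [← Real.exp_add]
          refine Real.exp_le_exp.2 ?_
          nlinarith

lemma aux_step {Ω : Type*} (m : MeasurableSpace Ω) {m0 : MeasurableSpace Ω} (P : Measure Ω)
    [IsProbabilityMeasure P] (hm : m ≤ m0) (X : Ω → ℝ) (hX : Measurable X) (b c l : ℝ)
    (hb : 1 ≤ b) (hc : 0 < c) (hi : Integrable X P) (h0 : P[X | m] =ᵐ[P] 0)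
    (h1 : ∀ θ : ℝ, 0 < θ → P[Set.indicator {ω | θ < X ω} (fun _ => (1:ℝ)) | m]
        ≤ᵐ[P] fun _ => b * Real.exp (-(c * θ^2)))
    (h2 : ∀ θ : ℝ, 0 < θ → P[Set.indicator {ω | X ω < -θ} (fun _ => (1:ℝ)) | m]
        ≤ᵐ[P] fun _ => b * Real.exp (-(c * θ^2)))
    (g : Ω → ENNReal) (hg : Measurable[m] g) :
    ∫⁻ ω, g ω * ENNReal.ofReal (Real.exp (l * X ω)) ∂P
      ≤ ENNReal.ofReal (Real.exp (7 * l^2 * (b / c))) * ∫⁻ ω, g ω ∂P := by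
  have key : ∀ (S A : Set Ω) (r : ℝ), MeasurableSet S → MeasurableSet[m] A → 0 ≤ r →
      P[Set.indicator S (fun _ => (1:ℝ)) | m] ≤ᵐ[P] (fun _ => r) →
      P.restrict A S ≤ ENNReal.ofReal r * P.restrict A Set.univ := by
    intro S A r hS hA hr h
    have hInt : Integrable (Set.indicator S (fun _ => (1:ℝ))) P :=
      (integrable_const 1).indicator hS
    have e := setIntegral_condExp hm hInt hA
    have e2 : ∫ x in A, Set.indicator S (fun _ => (1:ℝ)) x ∂P = (P.restrict A).real S := by
      rw [integral_indicator hS]; simp [measureReal_def]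
    have e3 : ∫ x in A, (P[Set.indicator S (fun _ => (1:ℝ)) | m]) x ∂P ≤ ∫ x in A, r ∂P :=
      integral_mono_ae integrable_condExp.integrableOn (integrable_const r)
        (ae_restrict_of_ae h)
    rw [e, e2, integral_const, smul_eq_mul] at e3
    rw [← ofReal_measureReal (μ := P.restrict A) (s := S),
      ← ofReal_measureReal (μ := P.restrict A) (s := Set.univ), ← ENNReal.ofReal_mul hr]
    exact ENNReal.ofReal_le_ofReal (by rw [mul_comm]; exact e3)
  have hset : ∀ A, MeasurableSet[m] A → ∫⁻ ω in A, ENNReal.ofReal (Real.exp (l * X ω)) ∂P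
      ≤ ENNReal.ofReal (Real.exp (7 * l^2 * (b / c))) * P A := by
    intro A hA
    have := aux_mgf (P.restrict A) X hX b c l hb hc hi.integrableOn
      (by rw [← setIntegral_condExp hm hi hA, integral_congr_ae (ae_restrict_of_ae h0)]; simp)
      (fun θ hθ => key _ A _ (measurableSet_lt measurable_const hX) hA (by positivity) (h1 θ hθ))
      (fun θ hθ => key _ A _ (measurableSet_lt hX measurable_const) hA (by positivity) (h2 θ hθ))
    simpa using this
  set K := ENNReal.ofReal (Real.exp (7 * l^2 * (b / c)))
  have hh : Measurable fun ω => ENNReal.ofReal (Real.exp (l * X ω)) := by fun_prop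
  have hmeas : (P.withDensity fun ω => ENNReal.ofReal (Real.exp (l * X ω))).trim hm
      ≤ K • P.trim hm := by
    refine Measure.le_iff.2 fun A hA => ?_
    rw [trim_measurableSet_eq hm hA, withDensity_apply _ (hm A hA), Measure.smul_apply,
      trim_measurableSet_eq hm hA]
    exact hset A hA
  calc _ = ∫⁻ ω, g ω ∂(P.withDensity fun ω => ENNReal.ofReal (Real.exp (l * X ω))) := by
        rw [lintegral_withDensity_eq_lintegral_mul _ hh (hg.mono hm le_rfl)]
        simp [mul_comm]
    _ = ∫⁻ ω, g ω ∂((P.withDensity fun ω => ENNReal.ofReal (Real.exp (l * X ω))).trim hm) := by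
        rw [lintegral_trim hm hg]
    _ ≤ ∫⁻ ω, g ω ∂(K • P.trim hm) := lintegral_mono' hmeas le_rfl
    _ = _ := by rw [lintegral_smul_measure, lintegral_trim hm hg, smul_eq_mul]

/-- A variant of the Azuma–Hoeffding inequality for martingale difference sequences
with sub-Gaussian conditional tails. -/
theorem azuma_hoeffding_variant
    {Ω : Type*} {m0 : MeasurableSpace Ω} (P : Measure Ω) [IsProbabilityMeasure P]
    (T : ℕ) (hT : 1 ≤ T)
    (𝔉 : ℕ → MeasurableSpace Ω) (hmono : Monotone 𝔉) (hle : ∀ t, 𝔉 t ≤ m0)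
    (ξ : ℕ → Ω → ℝ)
    (hint : ∀ t ∈ Finset.Icc 1 T, Integrable (ξ t) P)
    (hadapted : ∀ t ∈ Finset.Icc 1 T, @Measurable Ω ℝ (𝔉 t) _ (ξ t))
    -- martingale difference: `E[ξ_t | 𝔉_{t-1}] = 0` a.s.
    (hmds : ∀ t ∈ Finset.Icc 1 T, P[ξ t | 𝔉 (t-1)] =ᵐ[P] 0)
    (b c : ℕ → ℝ)
    (hb : ∀ t ∈ Finset.Icc 1 T, 1 ≤ b t)
    (hc : ∀ t ∈ Finset.Icc 1 T, 0 < c t)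
    -- conditional tail bounds: a.s. `P(ξ_t > θ | 𝔉_{t-1}) ≤ b_t exp (-c_t θ²)`
    (htail₁ : ∀ t ∈ Finset.Icc 1 T, ∀ θ : ℝ, 0 < θ →
      P[Set.indicator {ω | θ < ξ t ω} (fun _ => (1:ℝ)) | 𝔉 (t-1)]
        ≤ᵐ[P] fun _ => b t * Real.exp (-(c t * θ^2)))
    -- and a.s. `P(ξ_t < -θ | 𝔉_{t-1}) ≤ b_t exp (-c_t θ²)`
    (htail₂ : ∀ t ∈ Finset.Icc 1 T, ∀ θ : ℝ, 0 < θ →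
      P[Set.indicator {ω | ξ t ω < -θ} (fun _ => (1:ℝ)) | 𝔉 (t-1)]
        ≤ᵐ[P] fun _ => b t * Real.exp (-(c t * θ^2)))
    (δ : ℝ) (hδ : δ ∈ Set.Ioo (0:ℝ) 1) :
    ENNReal.ofReal (1 - δ) ≤
      P {ω | (1/(T:ℝ)) * ∑ t ∈ Finset.Icc 1 T, ξ t ω
        ≤ Real.sqrt (28 * (∑ t ∈ Finset.Icc 1 T, b t / c t) * Real.log (1/δ) / (T:ℝ)^2)} := by
  have hind : ∀ l : ℝ, ∀ n : ℕ, n ≤ T →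
      ∫⁻ ω, ENNReal.ofReal (Real.exp (l * ∑ t ∈ Finset.Icc 1 n, ξ t ω)) ∂P
        ≤ ENNReal.ofReal (Real.exp (7 * l^2 * ∑ t ∈ Finset.Icc 1 n, b t / c t)) := by
    intro l n
    induction n with
    | zero => intro _; simp
    | succ n ih =>
      intro hn
      have hmem : n + 1 ∈ Finset.Icc 1 T := Finset.mem_Icc.2 ⟨by omega, hn⟩
      have hsm : Measurable[𝔉 n] fun ω => ∑ t ∈ Finset.Icc 1 n, ξ t ω := by
        refine Finset.measurable_fun_sum _ fun t ht => ?_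
        have := Finset.mem_Icc.1 ht
        exact (hadapted t (Finset.mem_Icc.2 ⟨this.1, by omega⟩)).mono (hmono this.2) le_rfl
      have hgm : Measurable[𝔉 n]
          fun ω => ENNReal.ofReal (Real.exp (l * ∑ t ∈ Finset.Icc 1 n, ξ t ω)) :=
        ENNReal.measurable_ofReal.comp (Real.measurable_exp.comp (hsm.const_mul l))
      have := aux_step (𝔉 n) P (hle n) (ξ (n+1)) ((hadapted _ hmem).mono (hle _) le_rfl)
        (b (n+1)) (c (n+1)) l (hb _ hmem) (hc _ hmem) (hint _ hmem) (hmds _ hmem)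
        (htail₁ _ hmem) (htail₂ _ hmem) _ hgm
      simp only [Finset.sum_Icc_succ_top (show 1 ≤ n + 1 by omega), mul_add, Real.exp_add]
      simp only [ENNReal.ofReal_mul (Real.exp_pos _).le]
      refine this.trans ?_
      rw [mul_comm]
      gcongr
      exact ih (by omega)
  obtain ⟨hδ0, hδ1⟩ := hδ
  set B := ∑ t ∈ Finset.Icc 1 T, b t / c t with hB
  have hBpos : 0 < B := Finset.sum_pos
    (fun t ht => div_pos (by linarith [hb t ht]) (hc t ht)) ⟨1, Finset.mem_Icc.2 ⟨le_rfl, hT⟩⟩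
  set L := Real.log (1/δ) with hL
  have hLpos : 0 < L := Real.log_pos (by rw [lt_div_iff₀ hδ0]; linarith)
  have hTpos : (0:ℝ) < T := by exact_mod_cast hT
  set s := Real.sqrt (28 * B * L) with hs
  have hs2 : s^2 = 28 * B * L := Real.sq_sqrt (by positivity)
  have hspos : 0 < s := Real.sqrt_pos.2 (by positivity)
  have hSm : Measurable fun ω => ∑ t ∈ Finset.Icc 1 T, ξ t ω :=
    Finset.measurable_fun_sum _ fun t ht => (hadapted t ht).mono (hle t) le_rfl
  have hsq : Real.sqrt (28 * B * L / (T:ℝ)^2) = s / T := by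
    rw [Real.sqrt_div (by positivity), Real.sqrt_sq hTpos.le]
  have hset : {ω | (1/(T:ℝ)) * ∑ t ∈ Finset.Icc 1 T, ξ t ω ≤ Real.sqrt (28 * B * L / (T:ℝ)^2)}
      = {ω | s < ∑ t ∈ Finset.Icc 1 T, ξ t ω}ᶜ := by
    ext ω
    simp only [Set.mem_ofPred_eq, Set.mem_compl_iff, not_lt, hsq]
    rw [one_div_mul_eq_div, div_le_div_iff_of_pos_right hTpos]
  rw [hset, prob_compl_eq_one_sub (measurableSet_lt measurable_const hSm),
    ENNReal.ofReal_sub _ hδ0.le, ENNReal.ofReal_one]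
  refine tsub_le_tsub_left ?_ _
  set l := s / (14 * B) with hl
  have hlpos : 0 < l := by positivity
  have hmk := mul_meas_ge_le_lintegral (μ := P)
    (f := fun ω => ENNReal.ofReal (Real.exp (l * ∑ t ∈ Finset.Icc 1 T, ξ t ω)))
    (by fun_prop) (ENNReal.ofReal (Real.exp (l * s)))
  have hmk2 := hmk.trans (hind l T le_rfl)
  have hsub : {ω | s < ∑ t ∈ Finset.Icc 1 T, ξ t ω} ⊆ {ω | ENNReal.ofReal (Real.exp (l * s)) ≤
      ENNReal.ofReal (Real.exp (l * ∑ t ∈ Finset.Icc 1 T, ξ t ω))} := by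
    intro ω hω
    have hω : s < ∑ t ∈ Finset.Icc 1 T, ξ t ω := hω
    exact ENNReal.ofReal_le_ofReal (Real.exp_le_exp.2 (mul_le_mul_of_nonneg_left hω.le hlpos.le))
  have hE : Real.exp (7 * l^2 * B) = Real.exp (l * s) * δ := by
    have hd : δ = Real.exp (-L) := by
      rw [hL, one_div, Real.log_inv, neg_neg, Real.exp_log hδ0]
    rw [hd, ← Real.exp_add]
    congr 1
    have e1 : l * s = 2 * L := by
      rw [hl, div_mul_eq_mul_div, ← sq, hs2]; field_simp; norm_num
    have e2 : 7 * l^2 * B = L := by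
      rw [hl, div_pow, hs2]; field_simp; norm_num
    rw [e1, e2]; ring
  rw [← hB, hE, ENNReal.ofReal_mul (Real.exp_pos _).le] at hmk2
  refine (measure_mono hsub).trans ?_
  exact (ENNReal.mul_le_mul_iff_right (by simp [Real.exp_pos]) ENNReal.ofReal_ne_top).1 hmk2
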